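/- There are no positive real numbers a, b, c, d and positive integer λ/2 =: q such that the function Φ(z_1,z_2) = log(1 + |z_1|² + |z_2|² + a|z_1 z_2|² + b|z_1² z_2|² + c|z_1 z_2²|² + d|z_1² z_2²|²) satisfies the Monge–Ampère equation det(∂²Φ/∂z_α∂z̄_β) = e^{−qΦ} on a neighborhood of 0 ∈ ℂ². -/

import Mathlib

open scoped BigOperators

/-- Wirtinger derivative `∂f/∂z_α`. -/
noncomputable def wD {n : ℕ} (f : (Fin n → ℂ) → ℂ) (α : Fin n) (z : Fin n → ℂ) : ℂ :=
  (fderiv ℝ f z (Pi.single α 1) - Complex.I * fderiv ℝ f z (Pi.single α Complex.I)) / 2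

/-- Conjugate Wirtinger derivative `∂f/∂z̄_α`. -/
noncomputable def wDbar {n : ℕ} (f : (Fin n → ℂ) → ℂ) (α : Fin n) (z : Fin n → ℂ) : ℂ :=
  (fderiv ℝ f z (Pi.single α 1) + Complex.I * fderiv ℝ f z (Pi.single α Complex.I)) / 2

/-- The matrix `g_{αβ̄} = ∂²Φ/∂z_α ∂z̄_β` of a Kähler metric with potential `Φ`. -/
noncomputable def kahlerMatrix {n : ℕ} (Φ : (Fin n → ℂ) → ℝ) (z : Fin n → ℂ) :
    Matrix (Fin n) (Fin n) ℂ :=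
  fun α β => wD (fun w => wDbar (fun v => (Φ v : ℂ)) β w) α z

open ComplexConjugate

/-- `f` is real differentiable at `z` with Wirtinger derivatives `u`, `v`. -/
def HasW (f : (Fin 2 → ℂ) → ℂ) (z u v : Fin 2 → ℂ) : Prop :=
  ∃ f' : (Fin 2 → ℂ) →L[ℝ] ℂ, HasFDerivAt f f' z ∧
    ∀ α, f' (Pi.single α 1) = u α + v α ∧ f' (Pi.single α Complex.I) = Complex.I * (u α - v α)

theorem HasW.wD {f : (Fin 2 → ℂ) → ℂ} {z u v : Fin 2 → ℂ} (h : HasW f z u v) (α : Fin 2) :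
    wD f α z = u α := by
  obtain ⟨f', h, h'⟩ := h
  rw [_root_.wD, h.fderiv, (h' α).1, (h' α).2]
  linear_combination (-(u α - v α) / 2) * Complex.I_mul_I

theorem HasW.wDbar {f : (Fin 2 → ℂ) → ℂ} {z u v : Fin 2 → ℂ} (h : HasW f z u v) (α : Fin 2) :
    wDbar f α z = v α := by
  obtain ⟨f', h, h'⟩ := h
  rw [_root_.wDbar, h.fderiv, (h' α).1, (h' α).2]
  linear_combination ((u α - v α) / 2) * Complex.I_mul_I

theorem HasW.const (k : ℂ) (z : Fin 2 → ℂ) : HasW (fun _ => k) z 0 0 :=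
  ⟨0, hasFDerivAt_const k z, fun α => by simp⟩

theorem HasW.add {f g : (Fin 2 → ℂ) → ℂ} {z u v u' v' : Fin 2 → ℂ} (hf : HasW f z u v)
    (hg : HasW g z u' v') : HasW (fun w => f w + g w) z (u + u') (v + v') := by
  obtain ⟨f', h, h'⟩ := hf
  obtain ⟨g', k, k'⟩ := hg
  refine ⟨f' + g', h.add k, fun α => ⟨?_, ?_⟩⟩
  · simp only [_root_.add_apply, (h' α).1, (k' α).1, Pi.add_apply]; ring
  · simp only [_root_.add_apply, (h' α).2, (k' α).2, Pi.add_apply]; ring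

theorem HasW.mul {f g : (Fin 2 → ℂ) → ℂ} {z u v u' v' : Fin 2 → ℂ} (hf : HasW f z u v)
    (hg : HasW g z u' v') :
    HasW (fun w => f w * g w) z (f z • u' + g z • u) (f z • v' + g z • v) := by
  obtain ⟨f', h, h'⟩ := hf
  obtain ⟨g', k, k'⟩ := hg
  refine ⟨f z • g' + g z • f', h.mul k, fun α => ⟨?_, ?_⟩⟩
  · simp only [_root_.add_apply, _root_.smul_apply, smul_eq_mul,
      (h' α).1, (k' α).1, Pi.add_apply, Pi.smul_apply]; ring
  · simp only [_root_.add_apply, _root_.smul_apply, smul_eq_mul,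
      (h' α).2, (k' α).2, Pi.add_apply, Pi.smul_apply]; ring

theorem HasW.comp {f : (Fin 2 → ℂ) → ℂ} {z u v : Fin 2 → ℂ} (hf : HasW f z u v)
    {φ : ℂ → ℂ} {m : ℂ} (hφ : HasDerivAt φ m (f z)) :
    HasW (fun w => φ (f w)) z (m • u) (m • v) := by
  obtain ⟨f', h, h'⟩ := hf
  refine ⟨_, (hφ.hasFDerivAt.restrictScalars ℝ).comp z h, fun α => ⟨?_, ?_⟩⟩
  · simp [(h' α).1]; ring
  · simp [(h' α).2]; ring

theorem HasW.congr {f : (Fin 2 → ℂ) → ℂ} {z u v u' : Fin 2 → ℂ} (hf : HasW f z u v)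
    (e : u = u') : HasW f z u' v := e ▸ hf

theorem HasW.coord (β : Fin 2) (z : Fin 2 → ℂ) : HasW (fun w => w β) z (Pi.single β 1) 0 := by
  refine ⟨ContinuousLinearMap.proj β, hasFDerivAt_apply β z, fun α => ⟨?_, ?_⟩⟩
  · fin_cases α <;> fin_cases β <;> simp
  · fin_cases α <;> fin_cases β <;> simp

theorem HasW.cconj (β : Fin 2) (z : Fin 2 → ℂ) :
    HasW (fun w => conj (w β)) z 0 (Pi.single β 1) := by
  refine ⟨(Complex.conjCLE : ℂ →L[ℝ] ℂ).comp (ContinuousLinearMap.proj β),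
    ((Complex.conjCLE : ℂ →L[ℝ] ℂ).hasFDerivAt).comp z (hasFDerivAt_apply β z), fun α => ⟨?_, ?_⟩⟩
  · fin_cases α <;> fin_cases β <;> simp
  · fin_cases α <;> fin_cases β <;> simp

theorem HasW.X (β : Fin 2) (z : Fin 2 → ℂ) :
    HasW (fun w => w β * conj (w β)) z (Pi.single β (conj (z β))) (Pi.single β (z β)) := by
  have h := (HasW.coord β z).mul (HasW.cconj β z)
  convert h using 1
  · ext α; fin_cases α <;> fin_cases β <;> simp
  · ext α; fin_cases α <;> fin_cases β <;> simp

/-- The polynomial in `X`, `Y`. -/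
def pP {R : Type*} [CommRing R] (a b c d x y : R) : R :=
  1 + x + y + a * (x * y) + b * (x * x * y) + c * (x * (y * y)) + d * (x * x * (y * y))

def pQ {R : Type*} [CommRing R] (a b c d x y : R) : R :=
  1 + a * y + 2 * b * (x * y) + c * (y * y) + 2 * d * (x * (y * y))

/-- derivative of pQ in x -/
def pQx {R : Type*} [CommRing R] (b d y : R) : R := 2 * b * y + 2 * d * (y * y)

def pQy {R : Type*} [CommRing R] (a b c d x y : R) : R :=
  a + 2 * b * x + 2 * c * y + 4 * d * (x * y)

theorem hasW_pP (a b c d : ℂ) (z : Fin 2 → ℂ) :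
    HasW (fun w => pP a b c d (w 0 * conj (w 0)) (w 1 * conj (w 1))) z
      ![conj (z 0) * pQ a b c d (z 0 * conj (z 0)) (z 1 * conj (z 1)),
        conj (z 1) * pQ a c b d (z 1 * conj (z 1)) (z 0 * conj (z 0))]
      ![z 0 * pQ a b c d (z 0 * conj (z 0)) (z 1 * conj (z 1)),
        z 1 * pQ a c b d (z 1 * conj (z 1)) (z 0 * conj (z 0))] := by
  have k := fun r => HasW.const r z
  have x := HasW.X 0 z
  have y := HasW.X 1 z
  have h := ((((((k 1).add x).add y).add ((k a).mul (x.mul y))).add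
    ((k b).mul ((x.mul x).mul y))).add ((k c).mul (x.mul (y.mul y)))).add
    ((k d).mul ((x.mul x).mul (y.mul y)))
  unfold pP
  convert h using 1
  · ext α; fin_cases α <;> simp [pQ] <;> ring
  · ext α; fin_cases α <;> simp [pQ] <;> ring

theorem hasW_pQ0 (a b c d : ℂ) (z : Fin 2 → ℂ) : ∃ v,
    HasW (fun w => pQ a b c d (w 0 * conj (w 0)) (w 1 * conj (w 1))) z
      ![conj (z 0) * pQx b d (z 1 * conj (z 1)),
        conj (z 1) * pQy a b c d (z 0 * conj (z 0)) (z 1 * conj (z 1))] v := by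
  have k := fun r => HasW.const r z
  have x := HasW.X 0 z
  have y := HasW.X 1 z
  have h := ((((k 1).add ((k a).mul y)).add ((k (2 * b)).mul (x.mul y))).add
    ((k c).mul (y.mul y))).add ((k (2 * d)).mul (x.mul (y.mul y)))
  unfold pQ
  refine ⟨_, h.congr ?_⟩
  ext α; fin_cases α <;> simp [pQx, pQy] <;> ring

theorem hasW_pQ1 (a b c d : ℂ) (z : Fin 2 → ℂ) : ∃ v,
    HasW (fun w => pQ a c b d (w 1 * conj (w 1)) (w 0 * conj (w 0))) z
      ![conj (z 0) * pQy a b c d (z 0 * conj (z 0)) (z 1 * conj (z 1)),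
        conj (z 1) * pQx c d (z 0 * conj (z 0))] v := by
  have k := fun r => HasW.const r z
  have x := HasW.X 0 z
  have y := HasW.X 1 z
  have h := ((((k 1).add ((k a).mul x)).add ((k (2 * c)).mul (y.mul x))).add
    ((k b).mul (x.mul x))).add ((k (2 * d)).mul (y.mul (x.mul x)))
  unfold pQ
  refine ⟨_, h.congr ?_⟩
  ext α; fin_cases α <;> simp [pQx, pQy] <;> ring

theorem pot_eq (a b c d : ℝ) (z : Fin 2 → ℂ) :
    (1 + ‖z 0‖ ^ 2 + ‖z 1‖ ^ 2 + a * (‖z 0‖ ^ 2 * ‖z 1‖ ^ 2)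
              + b * (‖z 0‖ ^ 4 * ‖z 1‖ ^ 2) + c * (‖z 0‖ ^ 2 * ‖z 1‖ ^ 4)
              + d * (‖z 0‖ ^ 4 * ‖z 1‖ ^ 4)) = pP a b c d (‖z 0‖ ^ 2) (‖z 1‖ ^ 2) := by
  unfold pP; ring

theorem pP_pos {a b c d : ℝ} (ha : 0 < a) (hb : 0 < b) (hc : 0 < c) (hd : 0 < d) {x y : ℝ}
    (hx : 0 ≤ x) (hy : 0 ≤ y) : 0 < pP a b c d x y := by
  unfold pP; positivity

theorem pP_cast (a b c d : ℝ) (z : Fin 2 → ℂ) :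
    ((pP a b c d (‖z 0‖ ^ 2) (‖z 1‖ ^ 2) : ℝ) : ℂ) =
      pP (a : ℂ) b c d (z 0 * conj (z 0)) (z 1 * conj (z 1)) := by
  unfold pP; simp only [Complex.mul_conj']; push_cast; ring

theorem wDbar_pot {a b c d : ℝ} (ha : 0 < a) (hb : 0 < b) (hc : 0 < c) (hd : 0 < d)
    (β : Fin 2) (z : Fin 2 → ℂ) :
    wDbar (fun v : Fin 2 → ℂ => ((Real.log (pP a b c d (‖v 0‖ ^ 2) (‖v 1‖ ^ 2)) : ℝ) : ℂ)) β z =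
      (pP (a : ℂ) b c d (z 0 * conj (z 0)) (z 1 * conj (z 1)))⁻¹ *
      (![z 0 * pQ (a : ℂ) b c d (z 0 * conj (z 0)) (z 1 * conj (z 1)),
        z 1 * pQ (a : ℂ) c b d (z 1 * conj (z 1)) (z 0 * conj (z 0))] : Fin 2 → ℂ) β := by
  have hpos : ∀ v : Fin 2 → ℂ, 0 < pP a b c d (‖v 0‖ ^ 2) (‖v 1‖ ^ 2) := fun v =>
    pP_pos ha hb hc hd (by positivity) (by positivity)
  have e : (fun v : Fin 2 → ℂ => ((Real.log (pP a b c d (‖v 0‖ ^ 2) (‖v 1‖ ^ 2)) : ℝ) : ℂ)) =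
      fun v => Complex.log (pP (a : ℂ) b c d (v 0 * conj (v 0)) (v 1 * conj (v 1))) := by
    funext v
    rw [Complex.ofReal_log (hpos v).le, pP_cast]
  rw [e]
  have hs : pP (a : ℂ) b c d (z 0 * conj (z 0)) (z 1 * conj (z 1)) ∈ Complex.slitPlane := by
    rw [← pP_cast, Complex.ofReal_mem_slitPlane]; exact hpos z
  have h := (hasW_pP (a : ℂ) b c d z).comp (Complex.hasDerivAt_log hs)
  rw [h.wDbar]; simp

theorem key {a b c d : ℝ} (ha : 0 < a) (hb : 0 < b) (hc : 0 < c) (hd : 0 < d) (s t : ℝ) :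
    (kahlerMatrix (fun v : Fin 2 → ℂ => Real.log (pP a b c d (‖v 0‖ ^ 2) (‖v 1‖ ^ 2)))
      ![(s : ℂ), (t : ℂ)]).det * ((pP a b c d (s ^ 2) (t ^ 2) : ℝ) : ℂ) ^ 4 =
    ((((pQ a b c d (s ^ 2) (t ^ 2) + s ^ 2 * pQx b d (t ^ 2)) * pP a b c d (s ^ 2) (t ^ 2)
        - s ^ 2 * pQ a b c d (s ^ 2) (t ^ 2) ^ 2) *
      ((pQ a c b d (t ^ 2) (s ^ 2) + t ^ 2 * pQx c d (s ^ 2)) * pP a b c d (s ^ 2) (t ^ 2)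
        - t ^ 2 * pQ a c b d (t ^ 2) (s ^ 2) ^ 2)
      - s ^ 2 * t ^ 2 * (pQy a b c d (s ^ 2) (t ^ 2) * pP a b c d (s ^ 2) (t ^ 2)
        - pQ a b c d (s ^ 2) (t ^ 2) * pQ a c b d (t ^ 2) (s ^ 2)) ^ 2 : ℝ) : ℂ) := by
  set z : Fin 2 → ℂ := ![(s : ℂ), (t : ℂ)] with hz
  have z0 : z 0 = s := by simp [hz]
  have z1 : z 1 = t := by simp [hz]
  have hP : pP (a : ℂ) b c d (z 0 * conj (z 0)) (z 1 * conj (z 1)) ≠ 0 := by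
    rw [← pP_cast]
    exact_mod_cast (pP_pos ha hb hc hd (by positivity) (by positivity)).ne'
  have hinv := (hasW_pP (a : ℂ) b c d z).comp (hasDerivAt_inv hP)
  obtain ⟨v0, h0⟩ := hasW_pQ0 (a : ℂ) b c d z
  obtain ⟨v1, h1⟩ := hasW_pQ1 (a : ℂ) b c d z
  have H0 := hinv.mul ((HasW.coord 0 z).mul h0)
  have H1 := hinv.mul ((HasW.coord 1 z).mul h1)
  rw [Matrix.det_fin_two]
  unfold kahlerMatrix
  simp only [wDbar_pot ha hb hc hd]
  simp only [Matrix.cons_val_zero, Matrix.cons_val_one]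
  rw [H0.wD, H1.wD, H0.wD, H1.wD]
  have ep : pP (a : ℂ) b c d (z 0 * conj (z 0)) (z 1 * conj (z 1)) =
      ((pP a b c d (s ^ 2) (t ^ 2) : ℝ) : ℂ) := by
    rw [z0, z1]; unfold pP; simp only [Complex.conj_ofReal]; push_cast; ring
  have eq0 : pQ (a : ℂ) b c d (z 0 * conj (z 0)) (z 1 * conj (z 1)) =
      ((pQ a b c d (s ^ 2) (t ^ 2) : ℝ) : ℂ) := by
    rw [z0, z1]; unfold pQ; simp only [Complex.conj_ofReal]; push_cast; ring
  have eq1 : pQ (a : ℂ) c b d (z 1 * conj (z 1)) (z 0 * conj (z 0)) =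
      ((pQ a c b d (t ^ 2) (s ^ 2) : ℝ) : ℂ) := by
    rw [z0, z1]; unfold pQ; simp only [Complex.conj_ofReal]; push_cast; ring
  have ex0 : pQx (b : ℂ) d (z 1 * conj (z 1)) = ((pQx b d (t ^ 2) : ℝ) : ℂ) := by
    rw [z1]; unfold pQx; simp only [Complex.conj_ofReal]; push_cast; ring
  have ex1 : pQx (c : ℂ) d (z 0 * conj (z 0)) = ((pQx c d (s ^ 2) : ℝ) : ℂ) := by
    rw [z0]; unfold pQx; simp only [Complex.conj_ofReal]; push_cast; ring
  have ey : pQy (a : ℂ) b c d (z 0 * conj (z 0)) (z 1 * conj (z 1)) =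
      ((pQy a b c d (s ^ 2) (t ^ 2) : ℝ) : ℂ) := by
    rw [z0, z1]; unfold pQy; simp only [Complex.conj_ofReal]; push_cast; ring
  rw [ep] at hP
  clear H0 H1 h0 h1 hinv
  simp only [Pi.add_apply, Pi.smul_apply, smul_eq_mul]
  simp only [ep, eq0, eq1, ex0, ex1, ey]
  simp only [z0, z1, Complex.conj_ofReal]
  clear ep eq0 eq1 ex0 ex1 ey z0 z1 hz
  generalize pP a b c d (s ^ 2) (t ^ 2) = p at *
  generalize pQ a b c d (s ^ 2) (t ^ 2) = q0 at *
  generalize pQ a c b d (t ^ 2) (s ^ 2) = q1 at *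
  generalize pQx b d (t ^ 2) = x0 at *
  generalize pQx c d (s ^ 2) = x1 at *
  generalize pQy a b c d (s ^ 2) (t ^ 2) = y at *
  simp
  field_simp
  ring

theorem realkey {a b c d : ℝ} {q : ℕ} (ha : 0 < a) (hb : 0 < b) (hc : 0 < c) (hd : 0 < d)
    {U : Set (Fin 2 → ℂ)} (hU : U ∈ nhds (0 : Fin 2 → ℂ))
    (h : ∀ z ∈ U, (kahlerMatrix (fun z : Fin 2 → ℂ => Real.log
            (pP a b c d (‖z 0‖ ^ 2) (‖z 1‖ ^ 2))) z).det
          = Complex.exp (-(q : ℂ) * Real.log (pP a b c d (‖z 0‖ ^ 2) (‖z 1‖ ^ 2)))) :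
    ∃ ε > 0, ∀ x y : ℝ, 0 ≤ x → x < ε → 0 ≤ y → y < ε →
      (((pQ a b c d x y + x * pQx b d y) * pP a b c d x y - x * pQ a b c d x y ^ 2) *
      ((pQ a c b d y x + y * pQx c d x) * pP a b c d x y - y * pQ a c b d y x ^ 2)
      - x * y * (pQy a b c d x y * pP a b c d x y - pQ a b c d x y * pQ a c b d y x) ^ 2) *
        pP a b c d x y ^ q = pP a b c d x y ^ 4 := by
  obtain ⟨δ, hδ, hB⟩ := Metric.mem_nhds_iff.1 hU
  refine ⟨δ ^ 2, by positivity, fun x y hx hx' hy hy' => ?_⟩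
  have hs : √x ^ 2 = x := Real.sq_sqrt hx
  have ht : √y ^ 2 = y := Real.sq_sqrt hy
  have hs' : √x < δ := (Real.sqrt_lt' hδ).2 hx'
  have ht' : √y < δ := (Real.sqrt_lt' hδ).2 hy'
  have hm : (![((√x : ℝ) : ℂ), ((√y : ℝ) : ℂ)] : Fin 2 → ℂ) ∈ U := by
    apply hB
    rw [mem_ball_zero_iff, pi_norm_lt_iff hδ]
    intro i
    fin_cases i
    · simpa [abs_of_nonneg (Real.sqrt_nonneg x)] using hs'
    · simpa [abs_of_nonneg (Real.sqrt_nonneg y)] using ht'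
  have h1 := h _ hm
  have h2 := key ha hb hc hd (√x) (√y)
  rw [h1, hs, ht] at h2
  have hp : 0 < pP a b c d x y := pP_pos ha hb hc hd hx hy
  have e : Complex.exp (-(q : ℂ) * Real.log (pP a b c d
      (‖(![((√x : ℝ) : ℂ), ((√y : ℝ) : ℂ)] : Fin 2 → ℂ) 0‖ ^ 2)
      (‖(![((√x : ℝ) : ℂ), ((√y : ℝ) : ℂ)] : Fin 2 → ℂ) 1‖ ^ 2))) =
      (((pP a b c d x y ^ q)⁻¹ : ℝ) : ℂ) := by
    simp only [Matrix.cons_val_zero, Matrix.cons_val_one, Complex.norm_real, Real.norm_eq_abs,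
      sq_abs, hs, ht]
    have : -(q : ℂ) * ((Real.log (pP a b c d x y) : ℝ) : ℂ) =
        ((-(q * Real.log (pP a b c d x y)) : ℝ) : ℂ) := by push_cast; ring
    rw [this, ← Complex.ofReal_exp, Real.exp_neg, Real.exp_nat_mul, Real.exp_log hp]
  rw [e] at h2
  rw [← Complex.ofReal_pow, ← Complex.ofReal_mul] at h2
  have h3 := Complex.ofReal_injective h2
  rw [← h3]
  field_simp

theorem edge {a b : ℝ} {q : ℕ} (ha : 0 < a) (hb : 0 < b) (hq : 0 < q) {ε : ℝ} (hε : 0 < ε)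
    (h : ∀ x : ℝ, 0 ≤ x → x < ε → (1 + a * x + b * x ^ 2) * (1 + x) ^ (q + 1) = (1 + x) ^ 4) :
    q = 1 ∧ a = 2 ∧ b = 1 := by
  have h1 := h (ε / 2) (by positivity) (by linarith)
  have h2 := h (ε / 4) (by positivity) (by linarith)
  have key : ∀ {x : ℝ} {k : ℕ}, 0 < x →
      (1 + a * x + b * x ^ 2) * (1 + x) ^ (q + 1) = (1 + x) ^ 4 → q + 1 + k = 4 →
      1 + a * x + b * x ^ 2 = (1 + x) ^ k := by
    intro x k hx h hk
    rw [← hk, pow_add (1 + x) (q + 1) k, mul_comm] at h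
    exact mul_left_cancel₀ (by positivity) h
  have hε2 : (0 : ℝ) < ε / 2 := by positivity
  have hε4 : (0 : ℝ) < ε / 4 := by positivity
  rcases Nat.lt_or_ge q 3 with h3 | h3
  · have : q = 1 ∨ q = 2 := by omega
    rcases this with rfl | rfl
    · have k1 := key (k := 2) hε2 h1 rfl
      have k2 := key (k := 2) hε4 h2 rfl
      have l1 : a + b * (ε / 2) = 2 + ε / 2 :=
        mul_left_cancel₀ hε2.ne' (by linear_combination k1)
      have l2 : a + b * (ε / 4) = 2 + ε / 4 :=
        mul_left_cancel₀ hε4.ne' (by linear_combination k2)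
      have hb1 : b = 1 := mul_left_cancel₀ hε4.ne' (by linear_combination l1 - l2)
      refine ⟨rfl, ?_, hb1⟩
      subst hb1; linarith
    · exfalso
      have k1 := key (k := 1) hε2 h1 rfl
      have k2 := key (k := 1) hε4 h2 rfl
      have l1 : a + b * (ε / 2) = 1 :=
        mul_left_cancel₀ hε2.ne' (by linear_combination k1)
      have l2 : a + b * (ε / 4) = 1 :=
        mul_left_cancel₀ hε4.ne' (by linear_combination k2)
      nlinarith [mul_pos hb hε]
  · exfalso
    have p1 : (1 + ε / 2) ^ 4 ≤ (1 + ε / 2) ^ (q + 1) :=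
      pow_le_pow_right₀ (by linarith) (by omega)
    have p2 : 0 < (1 + ε / 2) ^ (q + 1) := by positivity
    have p3 : 0 < a * (ε / 2) + b * (ε / 2) ^ 2 := by positivity
    nlinarith [mul_pos p3 p2]

/-- no positive reals `a,b,c,d` and positive integer `q = λ/2` make
`Φ = log(1+|z₁|²+|z₂|²+a|z₁z₂|²+b|z₁²z₂|²+c|z₁z₂²|²+d|z₁²z₂²|²)` satisfy
`det(∂²Φ/∂z∂z̄) = e^{−qΦ}` near `0 ∈ ℂ²`. -/
theorem stmt12 :
    ¬ ∃ (a b c d : ℝ) (q : ℕ), 0 < a ∧ 0 < b ∧ 0 < c ∧ 0 < d ∧ 0 < q ∧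
      ∃ U ∈ nhds (0 : Fin 2 → ℂ), ∀ z ∈ U,
        (kahlerMatrix (fun z : Fin 2 → ℂ => Real.log
            (1 + ‖z 0‖ ^ 2 + ‖z 1‖ ^ 2 + a * (‖z 0‖ ^ 2 * ‖z 1‖ ^ 2)
              + b * (‖z 0‖ ^ 4 * ‖z 1‖ ^ 2) + c * (‖z 0‖ ^ 2 * ‖z 1‖ ^ 4)
              + d * (‖z 0‖ ^ 4 * ‖z 1‖ ^ 4))) z).det
          = Complex.exp (-(q : ℂ) * Real.log
            (1 + ‖z 0‖ ^ 2 + ‖z 1‖ ^ 2 + a * (‖z 0‖ ^ 2 * ‖z 1‖ ^ 2)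
              + b * (‖z 0‖ ^ 4 * ‖z 1‖ ^ 2) + c * (‖z 0‖ ^ 2 * ‖z 1‖ ^ 4)
              + d * (‖z 0‖ ^ 4 * ‖z 1‖ ^ 4))) := by
  rintro ⟨a, b, c, d, q, ha, hb, hc, hd, hq, U, hU, h⟩
  simp only [pot_eq] at h
  obtain ⟨ε, hε, H⟩ := realkey ha hb hc hd hU h
  obtain ⟨hq1, ha2, hb1⟩ := edge ha hb hq hε (fun x hx hx' => by
    have := H x 0 hx hx' le_rfl hε
    simp only [pP, pQ, pQx, pQy] at this
    ring_nf at this ⊢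
    linear_combination this)
  obtain ⟨-, -, hc1⟩ := edge ha hc hq hε (fun x hx hx' => by
    have := H 0 x le_rfl hε hx hx'
    simp only [pP, pQ, pQx, pQy] at this
    ring_nf at this ⊢
    linear_combination this)
  subst hq1 ha2 hb1 hc1
  obtain ⟨t, ht, ht'⟩ : ∃ t : ℝ, 0 < t ∧ t < min ε (min 1 (1 / d)) :=
    exists_between (by positivity)
  have hte : t < ε := lt_of_lt_of_le ht' (min_le_left _ _)
  have ht1 : t < 1 := lt_of_lt_of_le ht' ((min_le_right _ _).trans (min_le_left _ _))
  have htd : d * t < 1 := by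
    have : t < 1 / d := lt_of_lt_of_le ht' ((min_le_right _ _).trans (min_le_right _ _))
    rw [lt_div_iff₀ hd] at this
    linarith
  have E := H t t ht.le hte ht.le hte
  have hp : 0 < pP 2 1 1 d t t := pP_pos ha hb hc hd ht.le ht.le
  rw [pow_one, show (4 : ℕ) = 3 + 1 from rfl, pow_succ _ 3] at E
  have E2 := mul_right_cancel₀ hp.ne' E
  simp only [pP, pQ, pQx, pQy] at E2
  have E3 : 4 * t ^ 2 + (8 + 8 * d) * t ^ 3 + (9 + 23 * d) * t ^ 4 + (10 + 38 * d) * t ^ 5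
      + 56 * d * t ^ 6 + (42 * d + 8 * d ^ 2 - 2) * t ^ 7 + (30 * d + 6 * d ^ 2 - 4) * t ^ 8
      + (14 * d + 6 * d ^ 2 - 4) * t ^ 9 + 4 * d ^ 2 * t ^ 10 + (2 * d - 2 * d ^ 2) * t ^ 11
      + (d ^ 2 - d ^ 3) * t ^ 12 = 0 := by
    linear_combination E2
  have b1 : t ^ 7 ≤ t ^ 3 := pow_le_pow_of_le_one ht.le ht1.le (by norm_num)
  have b2 : t ^ 8 ≤ t ^ 4 := pow_le_pow_of_le_one ht.le ht1.le (by norm_num)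
  have b3 : t ^ 9 ≤ t ^ 5 := pow_le_pow_of_le_one ht.le ht1.le (by norm_num)
  have b4 : d ^ 2 * t ^ 11 ≤ d ^ 2 * t ^ 10 := by
    gcongr ?_ * ?_
    exact pow_le_pow_of_le_one ht.le ht1.le (by norm_num)
  have b5 : d ^ 3 * t ^ 12 ≤ d ^ 2 * t ^ 11 := by
    have : 0 ≤ d ^ 2 * t ^ 11 * (1 - d * t) := mul_nonneg (by positivity) (by linarith)
    linarith
  have b6 : 0 < 4 * t ^ 2 + (6 + 8 * d) * t ^ 3 + (5 + 23 * d) * t ^ 4 + (6 + 38 * d) * t ^ 5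
      + 56 * d * t ^ 6 + (42 * d + 8 * d ^ 2) * t ^ 7 + (30 * d + 6 * d ^ 2) * t ^ 8
      + (14 * d + 6 * d ^ 2) * t ^ 9 + d ^ 2 * t ^ 10 + 2 * d * t ^ 11
      + d ^ 2 * t ^ 12 := by positivity
  linarith
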